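/- For c > 0, the convolution operator (Cf)(y) = (1/(2πi)) ∫_ℝ f(x)/(x - y - 2ic) dx is a bounded operator on L^2(ℝ, ℂ) with operator norm equal to 1. -/

import Mathlib

open MeasureTheory
open scoped FourierTransform SchwartzMap ENNReal InnerProductSpace ContDiff

section FourierInv

variable {E F : Type*} [NormedAddCommGroup E] [InnerProductSpace ℝ E] [FiniteDimensional ℝ E]
  [MeasurableSpace E] [BorelSpace E] [NormedAddCommGroup F] [InnerProductSpace ℂ F]

/-- The Fourier inverse of an `L¹` function is continuous. -/
theorem continuous_fourierInv_of_integrable {f : E → F} (hf : Integrable f) :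
    Continuous (𝓕⁻ f) := by
  have h : 𝓕⁻ f = fun x ↦ 𝓕 f (-x) := funext (Real.fourierInv_eq_fourier_neg f)
  rw [h]
  exact (VectorFourier.fourierIntegral_continuous Real.continuous_fourierChar
    (by exact continuous_inner) hf).comp continuous_neg

/-- On `L¹` the inverse Fourier transform is self-adjoint against Schwartz functions. -/
theorem integral_schwartz_smul_fourierInv_eq [CompleteSpace F] {f : E → F} (hf : Integrable f)
    (φ : 𝓢(E, ℂ)) :
    ∫ x, 𝓕⁻ φ x • f x = ∫ x, φ x • 𝓕⁻ f x := by
  have key := VectorFourier.integral_fourierIntegral_smul_eq_flip (L := -innerₗ E) (μ := volume)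
    (ν := volume) (f := φ) (g := f) Real.continuous_fourierChar
    (by simpa using! continuous_inner.neg) φ.integrable hf
  rw [SchwartzMap.fourierInv_coe]
  convert key using 3 with x x
  · simp [Real.fourierInv_eq, VectorFourier.fourierIntegral]
  · simp [Real.fourierInv_eq, VectorFourier.fourierIntegral, real_inner_comm]

/-- On `L¹ ∩ L²` the `L²` inverse Fourier transform is given by the Fourier integral. -/
theorem MeasureTheory.MemLp.fourierInv_toLp_ae_eq [CompleteSpace F] {f : E → F}
    (hf₂ : MemLp f 2) (hf₁ : Integrable f) :
    (𝓕⁻ (hf₂.toLp f) : Lp (α := E) F 2) =ᵐ[volume] 𝓕⁻ f := by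
  refine ae_eq_of_integral_contDiff_smul_eq ((Lp.memLp _).locallyIntegrable one_le_two)
    (continuous_fourierInv_of_integrable hf₁).locallyIntegrable fun g g_smooth g_cpt ↦ ?_
  have hg₁ : HasCompactSupport (Complex.ofRealCLM ∘ g) := g_cpt.comp_left rfl
  have hg₂ : ContDiff ℝ ∞ (Complex.ofRealCLM ∘ g) := by fun_prop
  set φ : 𝓢(E, ℂ) := hg₁.toSchwartzMap hg₂ with hφ
  have h := congrArg (fun T ↦ T φ) (Lp.fourierInv_toTemperedDistribution_eq (hf₂.toLp f))
  simp only [TemperedDistribution.fourierInv_apply, Lp.toTemperedDistribution_apply] at h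
  have h' : ∫ x, 𝓕⁻ φ x • (hf₂.toLp f) x = ∫ x, 𝓕⁻ φ x • f x :=
    integral_congr_ae <| by
      filter_upwards [hf₂.coeFn_toLp] with x hx
      rw [hx]
  rw [h', integral_schwartz_smul_fourierInv_eq hf₁] at h
  simpa [hφ] using h.symm

end FourierInv

/-- The Fourier multiplier `ξ ↦ exp (-4πcξ) 1_{ξ > 0}` of the Cauchy operator. -/
noncomputable def cauchyMultiplier (c : ℝ) : ℝ → ℂ :=
  (Set.Ioi 0).indicator fun ξ ↦ Complex.exp ((-(4 * Real.pi * c) : ℂ) * ξ)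

theorem norm_cauchyMultiplier_of_pos (c : ℝ) {ξ : ℝ} (hξ : 0 < ξ) :
    ‖cauchyMultiplier c ξ‖ = Real.exp (-(4 * Real.pi * c) * ξ) := by
  rw [cauchyMultiplier, Set.indicator_of_mem (Set.mem_Ioi.2 hξ), Complex.norm_exp]
  simp

theorem norm_cauchyMultiplier_le_one {c : ℝ} (hc : 0 < c) (ξ : ℝ) :
    ‖cauchyMultiplier c ξ‖ ≤ 1 := by
  rcases le_or_gt ξ 0 with hξ | hξ
  · simp [cauchyMultiplier, hξ]
  · rw [norm_cauchyMultiplier_of_pos c hξ, Real.exp_le_one_iff]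
    have := Real.pi_pos
    have : 0 < 4 * Real.pi * c * ξ := by positivity
    linarith

theorem measurable_cauchyMultiplier (c : ℝ) : Measurable (cauchyMultiplier c) :=
  Measurable.indicator (by fun_prop) measurableSet_Ioi

theorem integrable_cauchyMultiplier {c : ℝ} (hc : 0 < c) : Integrable (cauchyMultiplier c) := by
  refine (integrable_indicator_iff measurableSet_Ioi).2 (integrableOn_exp_mul_complex_Ioi ?_ 0)
  simp [Real.pi_pos, hc]

theorem memLp_top_cauchyMultiplier {c : ℝ} (hc : 0 < c) : MemLp (cauchyMultiplier c) ∞ :=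
  memLp_top_of_bound (measurable_cauchyMultiplier c).aestronglyMeasurable 1
    (.of_forall (norm_cauchyMultiplier_le_one hc))

theorem memLp_two_cauchyMultiplier {c : ℝ} (hc : 0 < c) : MemLp (cauchyMultiplier c) 2 := by
  refine (memLp_two_iff_integrable_sq_norm
    (measurable_cauchyMultiplier c).aestronglyMeasurable).2 ?_
  refine (integrable_cauchyMultiplier hc).norm.mono'
    ((measurable_cauchyMultiplier c).norm.pow_const 2).aestronglyMeasurable (.of_forall fun ξ ↦ ?_)
  have h₀ := norm_nonneg (cauchyMultiplier c ξ)
  have h₁ := norm_cauchyMultiplier_le_one hc ξ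
  rw [Real.norm_of_nonneg (by positivity)]
  nlinarith

/-- The Fourier multiplier of the Cauchy operator modulated by the frequency `-y`. -/
noncomputable def modulatedCauchyMultiplier (c y : ℝ) (ξ : ℝ) : ℂ :=
  Complex.exp (-(2 * Real.pi * y * Complex.I) * ξ) * cauchyMultiplier c ξ

theorem norm_modulatedCauchyMultiplier (c y ξ : ℝ) :
    ‖modulatedCauchyMultiplier c y ξ‖ = ‖cauchyMultiplier c ξ‖ := by
  simp [modulatedCauchyMultiplier, Complex.norm_exp]

theorem measurable_modulatedCauchyMultiplier (c y : ℝ) :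
    Measurable (modulatedCauchyMultiplier c y) :=
  Measurable.mul (by fun_prop) (measurable_cauchyMultiplier c)

theorem integrable_modulatedCauchyMultiplier {c : ℝ} (hc : 0 < c) (y : ℝ) :
    Integrable (modulatedCauchyMultiplier c y) :=
  (integrable_cauchyMultiplier hc).mono
    (measurable_modulatedCauchyMultiplier c y).aestronglyMeasurable
    (.of_forall fun ξ ↦ (norm_modulatedCauchyMultiplier c y ξ).le)

theorem memLp_two_modulatedCauchyMultiplier {c : ℝ} (hc : 0 < c) (y : ℝ) :
    MemLp (modulatedCauchyMultiplier c y) 2 :=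
  (memLp_two_cauchyMultiplier hc).mono
    (measurable_modulatedCauchyMultiplier c y).aestronglyMeasurable
    (.of_forall fun ξ ↦ (norm_modulatedCauchyMultiplier c y ξ).le)

theorem fourierInv_modulatedCauchyMultiplier {c : ℝ} (hc : 0 < c) (y x : ℝ) :
    𝓕⁻ (modulatedCauchyMultiplier c y) x
      = 1 / (4 * Real.pi * c - 2 * Real.pi * Complex.I * (x - y)) := by
  set a : ℂ := -(4 * Real.pi * c - 2 * Real.pi * Complex.I * (x - y)) with ha
  have hre : a.re < 0 := by
    simp [ha, Real.pi_pos, hc]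
  have h : (fun ξ : ℝ ↦ Complex.exp (↑(2 * Real.pi * inner ℝ ξ x) * Complex.I)
        • modulatedCauchyMultiplier c y ξ)
      = (Set.Ioi 0).indicator fun ξ : ℝ ↦ Complex.exp (a * ξ) := by
    funext ξ
    by_cases hξ : ξ ∈ Set.Ioi (0 : ℝ)
    · simp only [modulatedCauchyMultiplier, cauchyMultiplier, Set.indicator_of_mem hξ, smul_eq_mul,
        ← Complex.exp_add]
      congr 1
      simp [ha]
      ring
    · simp [modulatedCauchyMultiplier, cauchyMultiplier, Set.indicator_of_notMem hξ]
  rw [Real.fourierInv_eq', h, integral_indicator measurableSet_Ioi,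
    integral_exp_mul_complex_Ioi hre]
  rw [ha, neg_div_neg_eq]
  simp

/-- The Cauchy operator on `L²(ℝ)`, realised as a Fourier multiplier. -/
noncomputable def cauchyOperator {c : ℝ} (hc : 0 < c) :
    Lp ℂ 2 (volume : Measure ℝ) →L[ℂ] Lp ℂ 2 (volume : Measure ℝ) :=
  FourierTransform.fourierInvCLM ℂ (Lp ℂ 2 (volume : Measure ℝ)) ∘L
    (ContinuousLinearMap.mul ℂ ℂ).holderL volume ∞ 2 2 ((memLp_top_cauchyMultiplier hc).toLp _) ∘L
      FourierTransform.fourierCLM ℂ (Lp ℂ 2 (volume : Measure ℝ))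

theorem coeFn_holderL_cauchyMultiplier {c : ℝ} (hc : 0 < c) (f : Lp ℂ 2 (volume : Measure ℝ)) :
    (ContinuousLinearMap.mul ℂ ℂ).holderL volume ∞ 2 2 ((memLp_top_cauchyMultiplier hc).toLp _) f
      =ᵐ[volume] fun ξ ↦ cauchyMultiplier c ξ * f ξ := by
  filter_upwards [(ContinuousLinearMap.mul ℂ ℂ).coeFn_holder (r := 2)
    ((memLp_top_cauchyMultiplier hc).toLp _) f, (memLp_top_cauchyMultiplier hc).coeFn_toLp]
    with ξ h₁ h₂
  rw [← h₂]
  exact h₁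

theorem cauchyOperator_apply_ae {c : ℝ} (hc : 0 < c) (f : Lp ℂ 2 (volume : Measure ℝ)) :
    ∀ᵐ y : ℝ, cauchyOperator hc f y = (1 / (2 * Real.pi * Complex.I)) *
      ∫ x : ℝ, f x / ((x : ℂ) - y - 2 * c * Complex.I) := by
  set g : Lp ℂ 2 (volume : Measure ℝ) := 𝓕 f
  have hint : Integrable fun ξ ↦ cauchyMultiplier c ξ * g ξ :=
    (memLp_two_cauchyMultiplier hc).integrable_mul (Lp.memLp g)
  have hmem : MemLp (fun ξ ↦ cauchyMultiplier c ξ * g ξ) 2 :=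
    (memLp_congr_ae (coeFn_holderL_cauchyMultiplier hc g)).1 (Lp.memLp _)
  have hC : cauchyOperator hc f = 𝓕⁻ (hmem.toLp _) := by
    have : (ContinuousLinearMap.mul ℂ ℂ).holderL volume ∞ 2 2
        ((memLp_top_cauchyMultiplier hc).toLp _) g = hmem.toLp _ :=
      Lp.ext ((coeFn_holderL_cauchyMultiplier hc g).trans hmem.coeFn_toLp.symm)
    rw [← this]
    rfl
  rw [hC]
  filter_upwards [hmem.fourierInv_toLp_ae_eq hint] with y hy
  have hG := memLp_two_modulatedCauchyMultiplier hc y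
  have h₁ : 𝓕⁻ (fun ξ ↦ cauchyMultiplier c ξ * g ξ) y = ⟪hG.toLp _, g⟫_ℂ := by
    rw [Real.fourierInv_eq', L2.inner_def]
    refine integral_congr_ae ?_
    filter_upwards [hG.coeFn_toLp] with ξ hξ
    rw [hξ]
    by_cases h0 : ξ ∈ Set.Ioi (0 : ℝ)
    · simp [modulatedCauchyMultiplier, cauchyMultiplier, Set.indicator_of_mem h0,
        ← Complex.exp_conj, Complex.conj_ofNat, -Set.mem_Ioi]
      ring_nf
    · simp [modulatedCauchyMultiplier, cauchyMultiplier, Set.indicator_of_notMem h0]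
  have h₂ : ⟪hG.toLp _, g⟫_ℂ = ⟪(𝓕⁻ (hG.toLp _) : Lp ℂ 2 (volume : Measure ℝ)), f⟫_ℂ := by
    rw [← Lp.inner_fourier_eq (𝓕⁻ _), FourierTransform.fourier_fourierInv_eq]
  rw [hy, h₁, h₂, L2.inner_def, ← integral_const_mul]
  refine integral_congr_ae ?_
  filter_upwards [hG.fourierInv_toLp_ae_eq (integrable_modulatedCauchyMultiplier hc y)] with x hx
  have hI : (2 * Real.pi * Complex.I) * ((x : ℂ) - y - 2 * c * Complex.I)
      = 4 * Real.pi * c + 2 * Real.pi * Complex.I * (x - y) := by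
    linear_combination (-4 * Real.pi * c : ℂ) * Complex.I_sq
  rw [hx, fourierInv_modulatedCauchyMultiplier hc, div_mul_div_comm, hI]
  simp [div_eq_mul_inv, Complex.conj_ofNat]

theorem norm_cauchyOperator_apply {c : ℝ} (hc : 0 < c) (f : Lp ℂ 2 (volume : Measure ℝ)) :
    ‖cauchyOperator hc f‖ = ‖(ContinuousLinearMap.mul ℂ ℂ).holderL volume ∞ 2 2
      ((memLp_top_cauchyMultiplier hc).toLp _) (𝓕 f)‖ := by
  rw [← Lp.norm_fourier_eq]
  congr 1
  exact FourierTransform.fourier_fourierInv_eq _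

theorem norm_cauchyOperator_le_one {c : ℝ} (hc : 0 < c) : ‖cauchyOperator hc‖ ≤ 1 := by
  refine ContinuousLinearMap.opNorm_le_bound _ zero_le_one fun f ↦ ?_
  rw [norm_cauchyOperator_apply, ← Lp.norm_fourier_eq f]
  refine Lp.norm_le_mul_norm_of_ae_le_mul ?_
  filter_upwards [coeFn_holderL_cauchyMultiplier hc (𝓕 f)] with ξ hξ
  rw [hξ, norm_mul]
  gcongr
  exact norm_cauchyMultiplier_le_one hc ξ

theorem exp_le_norm_cauchyOperator {c : ℝ} (hc : 0 < c) {ε : ℝ} (hε : 0 < ε) :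
    Real.exp (-(4 * Real.pi * c) * ε) ≤ ‖cauchyOperator hc‖ := by
  have hvol : volume (Set.Ioo 0 ε) ≠ ⊤ := by simp
  set h : Lp ℂ 2 (volume : Measure ℝ) := indicatorConstLp 2 measurableSet_Ioo hvol 1 with hh
  have hpos : 0 < ‖h‖ := by
    rw [hh, norm_indicatorConstLp two_ne_zero ENNReal.ofNat_ne_top]
    simp [hε.le]
    positivity
  have hle : ‖h‖ ≤ Real.exp (4 * Real.pi * c * ε) * ‖cauchyOperator hc (𝓕⁻ h)‖ := by
    rw [norm_cauchyOperator_apply, FourierTransform.fourier_fourierInv_eq]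
    refine Lp.norm_le_mul_norm_of_ae_le_mul ?_
    filter_upwards [coeFn_holderL_cauchyMultiplier hc h,
      indicatorConstLp_coeFn (p := 2) (hs := measurableSet_Ioo) (hμs := hvol) (c := (1 : ℂ))]
      with ξ h₁ h₂
    rw [h₁, h₂, norm_mul]
    by_cases hξ : ξ ∈ Set.Ioo 0 ε
    · rw [Set.indicator_of_mem hξ, norm_cauchyMultiplier_of_pos c hξ.1, norm_one, mul_one,
        ← Real.exp_add, Real.one_le_exp_iff]
      have : 0 < 4 * Real.pi * c := by have := Real.pi_pos; positivity
      nlinarith [hξ.2]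
    · simp [Set.indicator_of_notMem hξ]
  have hinv : ‖(𝓕⁻ h : Lp ℂ 2 (volume : Measure ℝ))‖ = ‖h‖ := by
    rw [← Lp.norm_fourier_eq, FourierTransform.fourier_fourierInv_eq]
  have hop := (cauchyOperator hc).le_opNorm (𝓕⁻ h)
  rw [hinv] at hop
  have hexp : 0 < Real.exp (4 * Real.pi * c * ε) := Real.exp_pos _
  have : 1 ≤ Real.exp (4 * Real.pi * c * ε) * ‖cauchyOperator hc‖ := by
    refine le_of_mul_le_mul_right ?_ hpos
    calc 1 * ‖h‖ ≤ Real.exp (4 * Real.pi * c * ε) * ‖cauchyOperator hc (𝓕⁻ h)‖ := by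
          rwa [one_mul]
      _ ≤ Real.exp (4 * Real.pi * c * ε) * (‖cauchyOperator hc‖ * ‖h‖) := by gcongr
      _ = _ := by ring
  rw [neg_mul, Real.exp_neg]
  exact (inv_le_iff_one_le_mul₀' hexp).2 this

theorem norm_cauchyOperator {c : ℝ} (hc : 0 < c) : ‖cauchyOperator hc‖ = 1 := by
  refine (norm_cauchyOperator_le_one hc).antisymm ?_
  have hcont : Continuous fun ε : ℝ ↦ Real.exp (-(4 * Real.pi * c) * ε) := by fun_prop
  have htend := (hcont.tendsto 0).mono_left (nhdsWithin_le_nhds (s := Set.Ioi 0))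
  simp only [mul_zero, Real.exp_zero] at htend
  refine le_of_tendsto htend ?_
  filter_upwards [self_mem_nhdsWithin] with ε hε
  exact exp_le_norm_cauchyOperator hc hε

theorem stmt_3 (c : ℝ) (hc : 0 < c) :
    ∃ C : Lp ℂ 2 (volume : Measure ℝ) →L[ℂ] Lp ℂ 2 (volume : Measure ℝ),
      (∀ f : Lp ℂ 2 (volume : Measure ℝ), ∀ᵐ y : ℝ,
        (C f : ℝ → ℂ) y =
          (1 / (2 * Real.pi * Complex.I)) *
            ∫ x : ℝ, (f : ℝ → ℂ) x / ((x : ℂ) - y - 2 * c * Complex.I)) ∧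
      ‖C‖ = 1 :=
  ⟨cauchyOperator hc, cauchyOperator_apply_ae hc, norm_cauchyOperator hc⟩
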